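/- Let q ∈ (0,1), f : ℕ → ℕ with f(n)/log(n) → ∞, and for each n let p_all(n) be any number satisfying (1 - q^{f(n)})^n ≤ p_all(n) ≤ 1. Then p_all(n) → 1 as n → ∞. -/

import Mathlib

open Filter

/-- If `f n` eventually dominates every multiple of `log n`, then `n * q ^ f n` vanishes. -/
theorem tendsto_mul_pow_zero_of_superlog
    {q : ℝ} (hq0 : 0 < q) (hq1 : q < 1) {f : ℕ → ℕ}
    (hf : Tendsto (fun n : ℕ => (f n : ℝ) / Real.log n) atTop atTop) :
    Tendsto (fun n : ℕ => (n : ℝ) * q ^ f n) atTop (nhds 0) := by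
  have hlogq : Real.log q < 0 := Real.log_neg hq0 hq1
  refine squeeze_zero' (Eventually.of_forall fun n => by positivity) ?_
    (tendsto_inv_atTop_nhds_zero_nat (𝕜 := ℝ))
  filter_upwards [hf.eventually_ge_atTop (2 / -Real.log q), eventually_ge_atTop 2] with n hn hn2
  have hn1 : (1 : ℝ) < n := by exact_mod_cast hn2
  have hn0 : (0 : ℝ) < n := by linarith
  have hlogn : 0 < Real.log n := Real.log_pos hn1
  have hexp : (f n : ℝ) * Real.log q ≤ -(2 * Real.log n) := by
    rw [div_le_div_iff₀ (neg_pos.mpr hlogq) hlogn] at hn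
    linarith
  calc (n : ℝ) * q ^ f n
      = Real.exp (Real.log n + f n * Real.log q) := by
        rw [Real.exp_add, Real.exp_log hn0, Real.exp_nat_mul, Real.exp_log hq0]
    _ ≤ Real.exp (-Real.log n) := Real.exp_le_exp.mpr (by linarith)
    _ = (n : ℝ)⁻¹ := by rw [Real.exp_neg, Real.exp_log hn0]

/-- Proposition 5: under superlogarithmic growth of the number of
variables, any probability `p_all n` squeezed between `(1 - q^(f n))^n` and `1`
tends to `1`. -/
theorem p_all_tendsto_one
    (q : ℝ) (hq0 : 0 < q) (hq1 : q < 1) (f : ℕ → ℕ)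
    (hf : Tendsto (fun n : ℕ => (f n : ℝ) / Real.log n) atTop atTop)
    (p_all : ℕ → ℝ)
    (hlb : ∀ n, (1 - q ^ f n) ^ n ≤ p_all n)
    (hub : ∀ n, p_all n ≤ 1) :
    Tendsto p_all atTop (nhds 1) := by
  have hlim : Tendsto (fun n : ℕ => 1 - (n : ℝ) * q ^ f n) atTop (nhds 1) := by
    simpa using (tendsto_mul_pow_zero_of_superlog hq0 hq1 hf).const_sub 1
  refine tendsto_of_tendsto_of_tendsto_of_le_of_le hlim tendsto_const_nhds (fun n => ?_) hub
  have hpow : q ^ f n ≤ 1 := pow_le_one₀ hq0.le hq1.le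
  have bernoulli := one_add_mul_le_pow (a := -q ^ f n) (by linarith) n
  rw [mul_neg, ← sub_eq_add_neg, ← sub_eq_add_neg] at bernoulli
  exact bernoulli.trans (hlb n)
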